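/- Gauge characterization of conformal harmonic coordinates via contracted Christoffel symbols (Proposition 2.5, identity-chart coordinate version): Let n ≥ 3, k ∈ ℕ with k ≥ 2, α ∈ (0,1), and let g be a metric of class C^{k+α} on an open set U ⊆ ℝⁿ. Then the following are equivalent: (i) the identity coordinates are conformal harmonic for g, i.e. there exist functions f¹, …, fⁿ, f ∈ C²(U) with f > 0, L_g f¹ = ⋯ = L_g fⁿ = L_g f = 0 on U, and x^k = f^k(x)/f(x) for all x ∈ U and k = 1, …, n; (ii) there exists a positive function f ∈ C²(U) with L_g f = 0 on U and Γ_a(g) = 2 ∂_a (log f) on U for every a = 1, …, n. -/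

import Mathlib

noncomputable section

open Set Matrix Matrix

/-- Points of `ℝⁿ`. -/
abbrev Pt (n : ℕ) := Fin n → ℝ

/-- A metric in coordinates: a matrix-valued map. -/
abbrev Met (n : ℕ) := Pt n → Matrix (Fin n) (Fin n) ℝ

/-- Partial derivative of `f` in the `a`-th coordinate direction. -/
def pd {n : ℕ} (a : Fin n) (f : Pt n → ℝ) (x : Pt n) : ℝ :=
  fderiv ℝ f x (Pi.single a 1)

/-- `g` is a metric (pointwise symmetric positive definite) on `U`. -/
def IsMetricOn {n : ℕ} (g : Met n) (U : Set (Pt n)) : Prop :=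
  ∀ x ∈ U, (g x).IsSymm ∧ (g x).PosDef

/-- Christoffel symbols `Γ^c_{ab}` of `g`. -/
def christoffel {n : ℕ} (g : Met n) (c a b : Fin n) (x : Pt n) : ℝ :=
  (1 / 2) * ∑ d, (g x)⁻¹ c d *
    (pd a (fun y => g y b d) x + pd b (fun y => g y a d) x - pd d (fun y => g y a b) x)

/-- Ricci tensor `R_{ab}` of `g`. -/
def ricci {n : ℕ} (g : Met n) (a b : Fin n) (x : Pt n) : ℝ :=
  (∑ c, pd c (christoffel g c a b) x) - (∑ c, pd a (christoffel g c c b) x)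
    + (∑ c, ∑ d, christoffel g c a b x * christoffel g d d c x)
    - (∑ c, ∑ d, christoffel g d c b x * christoffel g c a d x)

/-- Scalar curvature `R(g)`. -/
def scalarCurv {n : ℕ} (g : Met n) (x : Pt n) : ℝ :=
  ∑ a, ∑ b, (g x)⁻¹ a b * ricci g a b x

/-- Laplace–Beltrami operator `Δ_g`. -/
def laplaceBeltrami {n : ℕ} (g : Met n) (u : Pt n → ℝ) (x : Pt n) : ℝ :=
  -(Real.sqrt (g x).det)⁻¹ *
    ∑ a, pd a (fun y => Real.sqrt (g y).det * ∑ b, (g y)⁻¹ a b * pd b u y) x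

/-- Conformal Laplacian `L_g`. -/
def confLap {n : ℕ} (g : Met n) (u : Pt n → ℝ) (x : Pt n) : ℝ :=
  laplaceBeltrami g u x + (((n : ℝ) - 2) / (4 * ((n : ℝ) - 1))) * scalarCurv g x * u x

/-- `f` is of class `C^{k+α}` on `s`: it is `C^k` there and its `k`-th order derivatives are
locally `α`-Hölder continuous. -/
def CHolderOn {n : ℕ} (k : ℕ) (α : ℝ) (s : Set (Pt n)) (f : Pt n → ℝ) : Prop :=
  ContDiffOn ℝ k f s ∧
    ∀ x ∈ s, ∃ C : NNReal, ∃ t ∈ nhdsWithin x s,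
      HolderOnWith C (Real.toNNReal α) (iteratedFDerivWithin ℝ k f s) t

/-- All entries of `g` are of class `C^{k+α}` on `s`. -/
def MetCHolderOn {n : ℕ} (k : ℕ) (α : ℝ) (s : Set (Pt n)) (g : Met n) : Prop :=
  ∀ a b, CHolderOn k α s fun x => g x a b

/-- Contracted Christoffel symbol `Γ^a = g^{bc} Γ^a_{bc}`. -/
def gammaUp {n : ℕ} (g : Met n) (a : Fin n) (x : Pt n) : ℝ :=
  ∑ b, ∑ c, (g x)⁻¹ b c * christoffel g a b c x

/-- Contracted Christoffel symbol `Γ_a = g_{ab} Γ^b`. -/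
def gammaLow {n : ℕ} (g : Met n) (a : Fin n) (x : Pt n) : ℝ :=
  ∑ b, g x a b * gammaUp g b x

/-- `g` satisfies the conformal harmonic gauge on `U`. -/
def ConfHarmonicGauge {n : ℕ} (g : Met n) (U : Set (Pt n)) : Prop :=
  ∃ f : Pt n → ℝ, ContDiffOn ℝ 2 f U ∧ (∀ x ∈ U, 0 < f x) ∧
    (∀ x ∈ U, confLap g f x = 0) ∧
    ∀ a : Fin n, ∀ x ∈ U, gammaLow g a x = 2 * pd a (fun y => Real.log (f y)) x

/-- Determinant-normalized metric `ĝ = (det g)^{-1/n} g`. -/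
def dnorm {n : ℕ} (g : Met n) : Met n :=
  fun x => ((g x).det ^ (-(1 : ℝ) / (n : ℝ))) • g x

/-- Jacobian matrix of a map `Z : ℝⁿ → ℝⁿ`. -/
def jac {n : ℕ} (Z : Pt n → Pt n) (x : Pt n) : Matrix (Fin n) (Fin n) ℝ :=
  Matrix.of fun i j => pd j (fun y => Z y i) x

/-- Riemann curvature tensor `R_{abc}{}^{d}`. -/
def riemannUp {n : ℕ} (g : Met n) (a b c d : Fin n) (x : Pt n) : ℝ :=
  pd a (christoffel g d b c) x - pd b (christoffel g d a c) x
    + (∑ e, christoffel g e b c x * christoffel g d a e x)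
    - (∑ e, christoffel g e a c x * christoffel g d b e x)

/-- Riemann curvature tensor `R_{abcd} = R_{abc}{}^{e} g_{ed}`. -/
def riemannLow {n : ℕ} (g : Met n) (a b c d : Fin n) (x : Pt n) : ℝ :=
  ∑ e, riemannUp g a b c e x * g x e d

/-- Schouten tensor `P_{ab}`. -/
def schouten {n : ℕ} (g : Met n) (a b : Fin n) (x : Pt n) : ℝ :=
  (1 / ((n : ℝ) - 2)) * (ricci g a b x - (scalarCurv g x / (2 * ((n : ℝ) - 1))) * g x a b)

/-- Weyl tensor `W_{abcd}`. -/
def weyl {n : ℕ} (g : Met n) (a b c d : Fin n) (x : Pt n) : ℝ :=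
  riemannLow g a b c d x + schouten g a c x * g x b d - schouten g b c x * g x a d
    + schouten g b d x * g x a c - schouten g a d x * g x b c

/-- Weyl tensor with raised last index, `W_{abc}{}^{d} = g^{de} W_{abce}`. -/
def weylUp {n : ℕ} (g : Met n) (a b c d : Fin n) (x : Pt n) : ℝ :=
  ∑ e, (g x)⁻¹ d e * weyl g a b c e x

/-- Covariant derivative of a 2-tensor: `(∇T)_{cab} = ∇_c T_{ab}`. -/
def cov2 {n : ℕ} (g : Met n) (T : Fin n → Fin n → Pt n → ℝ) (c a b : Fin n) (x : Pt n) : ℝ :=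
  pd c (T a b) x - (∑ d, christoffel g d c a x * T d b x)
    - ∑ d, christoffel g d c b x * T a d x

/-- Covariant derivative of a 3-tensor: `(∇T)_{dabc} = ∇_d T_{abc}`. -/
def cov3 {n : ℕ} (g : Met n) (T : Fin n → Fin n → Fin n → Pt n → ℝ) (d a b c : Fin n)
    (x : Pt n) : ℝ :=
  pd d (T a b c) x - (∑ e, christoffel g e d a x * T e b c x)
    - (∑ e, christoffel g e d b x * T a e c x)
    - ∑ e, christoffel g e d c x * T a b e x

/-- Cotton tensor `C_{abc} = ∇_a P_{bc} - ∇_b P_{ac}`. -/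
def cotton {n : ℕ} (g : Met n) (a b c : Fin n) (x : Pt n) : ℝ :=
  cov2 g (schouten g) a b c x - cov2 g (schouten g) b a c x

/-- Bach tensor `B_{ab}`. -/
def bach {n : ℕ} (g : Met n) (a b : Fin n) (x : Pt n) : ℝ :=
  (∑ c, ∑ d, (g x)⁻¹ c d *
      (cov3 g (cov2 g (schouten g)) d a b c x - cov3 g (cov2 g (schouten g)) d c a b x))
    + ∑ c, ∑ d, ∑ e, ∑ f, (g x)⁻¹ c e * (g x)⁻¹ d f * schouten g e f x * weyl g a c d b x

open Topology

lemma pd_congr {n : ℕ} {a : Fin n} {u v : Pt n → ℝ} {x : Pt n} (h : u =ᶠ[𝓝 x] v) :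
    pd a u x = pd a v x := by
  unfold pd; rw [h.fderiv_eq]

lemma pd_const {n : ℕ} (a : Fin n) (c : ℝ) (x : Pt n) : pd a (fun _ => c) x = 0 := by
  simp [pd]

lemma pd_coord {n : ℕ} (a i : Fin n) (x : Pt n) :
    pd a (fun y : Pt n => y i) x = if a = i then 1 else 0 := by
  have : fderiv ℝ (fun y : Pt n => y i) x = ContinuousLinearMap.proj i :=
    (ContinuousLinearMap.proj (R := ℝ) (φ := fun _ : Fin n => ℝ) i).hasFDerivAt.fderiv
  simp [pd, this, Pi.single_apply, eq_comm]

lemma pd_add {n : ℕ} {a : Fin n} {u v : Pt n → ℝ} {x : Pt n} (hu : DifferentiableAt ℝ u x)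
    (hv : DifferentiableAt ℝ v x) : pd a (fun y => u y + v y) x = pd a u x + pd a v x := by
  simp [pd, fderiv_fun_add hu hv]

lemma pd_mul {n : ℕ} {a : Fin n} {u v : Pt n → ℝ} {x : Pt n} (hu : DifferentiableAt ℝ u x)
    (hv : DifferentiableAt ℝ v x) :
    pd a (fun y => u y * v y) x = pd a u x * v x + u x * pd a v x := by
  simp [pd, fderiv_fun_mul hu hv]; ring

lemma pd_sum {n : ℕ} {ι : Type*} [Fintype ι] {a : Fin n} {u : ι → Pt n → ℝ} {x : Pt n}
    (hu : ∀ i, DifferentiableAt ℝ (u i) x) :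
    pd a (fun y => ∑ i, u i y) x = ∑ i, pd a (u i) x := by
  simp [pd, fderiv_fun_sum fun i _ => hu i]

lemma pd_log {n : ℕ} {a : Fin n} {u : Pt n → ℝ} {x : Pt n} (hu : DifferentiableAt ℝ u x)
    (h : u x ≠ 0) : pd a (fun y => Real.log (u y)) x = pd a u x / u x := by
  simp [pd, fderiv.log hu h]; field_simp

lemma pd_sqrt {n : ℕ} {a : Fin n} {u : Pt n → ℝ} {x : Pt n} (hu : DifferentiableAt ℝ u x)
    (h : u x ≠ 0) : pd a (fun y => Real.sqrt (u y)) x = pd a u x / (2 * Real.sqrt (u x)) := by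
  simp [pd, fderiv_sqrt hu h]; field_simp

lemma differentiableAt_matrix_det {n : ℕ} {M : Met n} {x : Pt n}
    (h : ∀ a b, DifferentiableAt ℝ (fun y => M y a b) x) :
    DifferentiableAt ℝ (fun y => (M y).det) x := by
  simp only [Matrix.det_apply]
  fun_prop

lemma differentiableAt_inv_entry {n : ℕ} {g : Met n} {x : Pt n}
    (h : ∀ a b, DifferentiableAt ℝ (fun y => g y a b) x) (hx : (g x).det ≠ 0) (i j : Fin n) :
    DifferentiableAt ℝ (fun y => (g y)⁻¹ i j) x := by
  simp only [Matrix.inv_def, Ring.inverse_eq_inv', Matrix.smul_apply, Matrix.adjugate_apply,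
    smul_eq_mul]
  refine ((differentiableAt_matrix_det h).inv hx).mul (differentiableAt_matrix_det fun a b => ?_)
  simp only [Matrix.updateRow_apply]
  split_ifs <;> fun_prop

/-- Jacobi's formula for the partial derivatives of a determinant. -/
lemma pd_det {n : ℕ} {g : Met n} {x : Pt n}
    (h : ∀ a b, DifferentiableAt ℝ (fun y => g y a b) x) (hx : (g x).det ≠ 0) (a : Fin n) :
    pd a (fun y => (g y).det) x =
      (g x).det * ∑ b, ∑ c, (g x)⁻¹ c b * pd a (fun y => g y b c) x := by
  let D : ContinuousMultilinearMap ℝ (fun _ : Fin n => Fin n → ℝ) ℝ :=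
    { (Matrix.detRowAlternating (R := ℝ) (n := Fin n)).toMultilinearMap with
      cont := Continuous.matrix_det (A := fun m : Fin n → Fin n → ℝ => Matrix.of m) continuous_id }
  have hD : ∀ m : Fin n → Fin n → ℝ, D m = (Matrix.of m).det := fun _ => rfl
  have hrow : ∀ i, DifferentiableAt ℝ (fun y => g y i) x := fun i =>
    differentiableAt_pi.2 fun j => h i j
  have hd : HasFDerivAt (fun y => (g y).det) _ x :=
    HasFDerivAt.multilinear_comp D fun i => (hrow i).hasFDerivAt
  have key : ∀ (i : Fin n) (w : Fin n → ℝ),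
      ((g x).updateRow i w).det = (g x).det * ∑ c, (g x)⁻¹ c i * w c := by
    intro i w
    rw [← Matrix.cramer_transpose_apply, Matrix.cramer_eq_adjugate_mulVec,
      ← Matrix.adjugate_transpose]
    simp only [Matrix.mulVec, dotProduct, Matrix.transpose_apply, Matrix.inv_def,
      Ring.inverse_eq_inv', Matrix.smul_apply, smul_eq_mul, Finset.mul_sum]
    refine Finset.sum_congr rfl fun c _ => ?_
    field_simp
  have hw : ∀ b c, fderiv ℝ (fun y => g y b) x (Pi.single a 1) c = pd a (fun y => g y b c) x := by
    intro b c
    have := (hasFDerivAt_pi'.1 (hrow b).hasFDerivAt c).fderiv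
    rw [pd, this]
    rfl
  rw [pd, hd.fderiv]
  simp only [FunLike.coe_sum, Finset.sum_apply, ContinuousLinearMap.comp_apply,
    ContinuousMultilinearMap.toContinuousLinearMap_apply, hD]
  rw [Finset.mul_sum]
  refine Finset.sum_congr rfl fun b _ => ?_
  simp only [← hw]
  exact key b _

lemma pd_inv {n : ℕ} {g : Met n} {x : Pt n}
    (h : ∀ a b, DifferentiableAt ℝ (fun y => g y a b) x) (hx : (g x).det ≠ 0) (a p q : Fin n) :
    pd a (fun y => (g y)⁻¹ p q) x =
      -∑ b, ∑ c, (g x)⁻¹ p b * pd a (fun y => g y b c) x * (g x)⁻¹ c q := by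
  have hu : IsUnit (g x).det := hx.isUnit
  have hev : ∀ᶠ y in 𝓝 x, (g y).det ≠ 0 :=
    (differentiableAt_matrix_det h).continuousAt.eventually_ne hx
  have hA := differentiableAt_inv_entry h hx
  have e : ∀ c, ∑ b, pd a (fun y => (g y)⁻¹ p b) x * g x b c =
      -∑ b, (g x)⁻¹ p b * pd a (fun y => g y b c) x := by
    intro c
    have h1 : pd a (fun y => ∑ b, (g y)⁻¹ p b * g y b c) x = 0 := by
      rw [← pd_const a ((1 : Matrix (Fin n) (Fin n) ℝ) p c) x]
      refine pd_congr ?_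
      filter_upwards [hev] with y hy
      rw [← Matrix.nonsing_inv_mul (g y) hy.isUnit, Matrix.mul_apply]
    rw [pd_sum fun b => (hA p b).fun_mul (h b c)] at h1
    simp only [fun b => pd_mul (a := a) (hA p b) (h b c), Finset.sum_add_distrib] at h1
    linarith
  calc pd a (fun y => (g y)⁻¹ p q) x
      = ∑ b, pd a (fun y => (g y)⁻¹ p b) x * (g x * (g x)⁻¹) b q := by
        simp [Matrix.mul_nonsing_inv (g x) hu, Matrix.one_apply]
    _ = ∑ c, (∑ b, pd a (fun y => (g y)⁻¹ p b) x * g x b c) * (g x)⁻¹ c q := by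
        simp only [Matrix.mul_apply, Finset.mul_sum, Finset.sum_mul]
        rw [Finset.sum_comm]
        simp only [mul_assoc]
    _ = _ := by
        simp only [e, neg_mul, Finset.sum_neg_distrib, Finset.sum_mul]
        rw [Finset.sum_comm]

/-- The coordinate expression `Γ^i = -(det g)^{-1/2} ∂_a ((det g)^{1/2} g^{ai})`. -/
lemma sum_pd_sqrt_det_mul_inv {n : ℕ} {g : Met n} {x : Pt n}
    (h : ∀ a b, DifferentiableAt ℝ (fun y => g y a b) x) (hx : 0 < (g x).det)
    (hs : ∀ᶠ y in 𝓝 x, (g y).IsSymm) (i : Fin n) :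
    ∑ a, pd a (fun y => Real.sqrt (g y).det * (g y)⁻¹ a i) x =
      -(Real.sqrt (g x).det * gammaUp g i x) := by
  have hd := differentiableAt_matrix_det h
  have hA := differentiableAt_inv_entry h hx.ne'
  have hsq : DifferentiableAt ℝ (fun y => Real.sqrt (g y).det) x := hd.sqrt hx.ne'
  have hsA : ∀ a b, (g x)⁻¹ a b = (g x)⁻¹ b a := fun a b => by
    have := Matrix.transpose_nonsing_inv (g x)
    rw [hs.self_of_nhds.eq] at this
    exact congr_fun (congr_fun this b) a
  have hpds : ∀ a, pd a (fun y => Real.sqrt (g y).det) x = Real.sqrt (g x).det *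
      ((1 / 2) * ∑ b, ∑ c, (g x)⁻¹ b c * pd a (fun y => g y b c) x) := by
    intro a
    rw [pd_sqrt hd hx.ne', pd_det h hx.ne']
    simp only [hsA]
    nth_rewrite 1 [← Real.mul_self_sqrt hx.le]
    field_simp
  simp only [fun a => pd_mul (a := a) hsq (hA a i), hpds, pd_inv h hx.ne', gammaUp, christoffel]
  generalize Real.sqrt (g x).det = s
  generalize hDe : (fun a b c => pd a (fun y => g y b c) x) = D at *
  have hDe' : ∀ a b c, pd a (fun y => g y b c) x = D a b c := fun a b c => by rw [← hDe]
  simp only [hDe'] at *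
  generalize (g x)⁻¹ = A at *
  have e1 : ∑ b, ∑ c, A b c * (1 / 2 * ∑ d, A i d * (D b c d + D c b d - D d b c)) =
      ∑ a, ∑ b, ∑ c, A a b * D a b c * A c i - ∑ a, (1 / 2 * ∑ b, ∑ c, A b c * D a b c) * A a i := by
    have t1 : ∑ b, ∑ c, ∑ d, A b c * (A i d * D b c d) = ∑ a, ∑ b, ∑ c, A a b * D a b c * A c i :=
      Finset.sum_congr rfl fun b _ => Finset.sum_congr rfl fun c _ =>
        Finset.sum_congr rfl fun d _ => by rw [hsA i d]; ring
    have t2 : ∑ b, ∑ c, ∑ d, A b c * (A i d * D c b d) = ∑ a, ∑ b, ∑ c, A a b * D a b c * A c i := by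
      rw [← t1, Finset.sum_comm]
      simp only [hsA]
    have t3 : ∑ b, ∑ c, ∑ d, A b c * (A i d * D d b c) =
        ∑ a, (∑ b, ∑ c, A b c * D a b c) * A a i := by
      simp only [Finset.sum_mul]
      symm
      rw [Finset.sum_comm]
      refine Finset.sum_congr rfl fun b _ => ?_
      rw [Finset.sum_comm]
      exact Finset.sum_congr rfl fun c _ => Finset.sum_congr rfl fun d _ => by rw [hsA i d]; ring
    calc _ = 1 / 2 * (∑ b, ∑ c, ∑ d, A b c * (A i d * D b c d) +
          ∑ b, ∑ c, ∑ d, A b c * (A i d * D c b d) -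
          ∑ b, ∑ c, ∑ d, A b c * (A i d * D d b c)) := by
          simp only [← Finset.sum_add_distrib, ← Finset.sum_sub_distrib]
          simp only [Finset.mul_sum]
          exact Finset.sum_congr rfl fun b _ => Finset.sum_congr rfl fun c _ =>
            Finset.sum_congr rfl fun d _ => by ring
      _ = _ := by
          rw [t1, t2, t3]
          simp only [mul_assoc, ← Finset.mul_sum]
          ring
  rw [e1]
  simp only [Finset.sum_add_distrib, mul_sub, Finset.mul_sum, mul_neg, Finset.sum_neg_distrib, Finset.sum_mul, mul_assoc]
  ring

/-- Product rule for the conformal Laplacian of a coordinate function times `f`. -/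
lemma confLap_coord_mul {n : ℕ} {g : Met n} {x : Pt n} {f : Pt n → ℝ}
    (h : ∀ a b, DifferentiableAt ℝ (fun y => g y a b) x) (hx : 0 < (g x).det)
    (hs : ∀ᶠ y in 𝓝 x, (g y).IsSymm) (hf : ContDiffAt ℝ 2 f x) (i : Fin n) :
    confLap g (fun y => y i * f y) x =
      x i * confLap g f x + f x * gammaUp g i x - 2 * ∑ b, (g x)⁻¹ i b * pd b f x := by
  have hA := differentiableAt_inv_entry h hx.ne'
  have hsq : DifferentiableAt ℝ (fun y => Real.sqrt (g y).det) x :=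
    (differentiableAt_matrix_det h).sqrt hx.ne'
  have hpos : 0 < Real.sqrt (g x).det := Real.sqrt_pos.2 hx
  have hfd : ∀ᶠ y in 𝓝 x, DifferentiableAt ℝ f y := by
    filter_upwards [hf.eventually (by simp)] with y hy using hy.differentiableAt (by simp)
  have hpf : ∀ b, DifferentiableAt ℝ (pd b f) x := fun b =>
    ((hf.fderiv_right (m := 1) (by norm_num)).differentiableAt (by simp)).clm_apply
      (differentiableAt_const _)
  have hcoord : ∀ y : Pt n, DifferentiableAt ℝ (fun z : Pt n => z i) y := fun y => by fun_prop
  have hsA : ∀ a b, (g x)⁻¹ a b = (g x)⁻¹ b a := fun a b => by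
    have := Matrix.transpose_nonsing_inv (g x)
    rw [hs.self_of_nhds.eq] at this
    exact congr_fun (congr_fun this b) a
  have hV : ∀ a, DifferentiableAt ℝ
      (fun y => Real.sqrt (g y).det * ∑ b, (g y)⁻¹ a b * pd b f y) x := fun a =>
    hsq.fun_mul (DifferentiableAt.fun_sum fun b _ => (hA a b).fun_mul (hpf b))
  have hstep : ∀ a, pd a (fun y => Real.sqrt (g y).det *
        ∑ b, (g y)⁻¹ a b * pd b (fun z => z i * f z) y) x =
      pd a (fun y => Real.sqrt (g y).det * (g y)⁻¹ a i) x * f x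
        + Real.sqrt (g x).det * ((g x)⁻¹ i a * pd a f x)
        + ((if a = i then 1 else 0) * (Real.sqrt (g x).det * ∑ b, (g x)⁻¹ a b * pd b f x)
        + x i * pd a (fun y => Real.sqrt (g y).det * ∑ b, (g y)⁻¹ a b * pd b f y) x) := by
    intro a
    have hev : (fun y => Real.sqrt (g y).det *
        ∑ b, (g y)⁻¹ a b * pd b (fun z => z i * f z) y) =ᶠ[𝓝 x]
        fun y => (Real.sqrt (g y).det * (g y)⁻¹ a i) * f y
          + y i * (Real.sqrt (g y).det * ∑ b, (g y)⁻¹ a b * pd b f y) := by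
      filter_upwards [hfd] with y hy
      simp only [fun b => pd_mul (a := b) (hcoord y) hy, pd_coord, mul_add,
        Finset.sum_add_distrib, ite_mul, one_mul, zero_mul, mul_ite, mul_zero,
        Finset.sum_ite_eq', Finset.mem_univ, if_true, Finset.mul_sum]
      congr 1
      · ring
      · exact Finset.sum_congr rfl fun b _ => by ring
    rw [pd_congr hev, pd_add ((hsq.fun_mul (hA a i)).fun_mul hfd.self_of_nhds)
      ((hcoord x).fun_mul (hV a)), pd_mul (hsq.fun_mul (hA a i)) hfd.self_of_nhds,
      pd_mul (hcoord x) (hV a), pd_coord, hsA i a, mul_assoc (Real.sqrt (g x).det)]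
  have hsum := sum_pd_sqrt_det_mul_inv h hx hs i
  unfold confLap laplaceBeltrami
  simp only [hstep, Finset.sum_add_distrib, ← Finset.sum_mul, ← Finset.mul_sum, hsum, ite_mul,
    one_mul, zero_mul, Finset.sum_ite_eq', Finset.mem_univ, if_true]
  field_simp
  ring

lemma confLap_congr {n : ℕ} {g : Met n} {x : Pt n} {u v : Pt n → ℝ} (h : u =ᶠ[𝓝 x] v) :
    confLap g u x = confLap g v x := by
  have : ∀ b, pd b u =ᶠ[𝓝 x] pd b v := fun b => by
    filter_upwards [h.eventuallyEq_nhds] with y hy using pd_congr hy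
  unfold confLap laplaceBeltrami
  rw [h.self_of_nhds]
  congr 2
  refine Finset.sum_congr rfl fun a _ => pd_congr ?_
  filter_upwards [Filter.eventually_all.2 this] with y hy
  simp only [hy]

/-- For `f` solving `L_g f = 0`, the function `x^i f` does so for all `i` exactly when
`Γ_a = 2 ∂_a log f`. -/
lemma confLap_coord_mul_eq_zero_iff {n : ℕ} {g : Met n} {x : Pt n} {f : Pt n → ℝ}
    (h : ∀ a b, DifferentiableAt ℝ (fun y => g y a b) x) (hx : 0 < (g x).det)
    (hs : ∀ᶠ y in 𝓝 x, (g y).IsSymm) (hf : ContDiffAt ℝ 2 f x) (hfx : 0 < f x)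
    (hL : confLap g f x = 0) :
    (∀ i, confLap g (fun y => y i * f y) x = 0) ↔
      ∀ a, gammaLow g a x = 2 * pd a (fun y => Real.log (f y)) x := by
  have hu : IsUnit (g x).det := hx.ne'.isUnit
  simp only [confLap_coord_mul h hx hs hf, hL, pd_log (hf.differentiableAt (by simp)) hfx.ne']
  constructor
  · intro H a
    have hG : ∀ i, gammaUp g i x = 2 * ((g x)⁻¹ *ᵥ fun b => pd b f x) i / f x := fun i => by
      have := H i
      simp only [Matrix.mulVec, dotProduct]
      rw [eq_div_iff hfx.ne']
      linarith
    have : (g x *ᵥ ((g x)⁻¹ *ᵥ fun b => pd b f x)) a = pd a f x := by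
      rw [Matrix.mulVec_mulVec, Matrix.mul_nonsing_inv _ hu, Matrix.one_mulVec]
    rw [← this, gammaLow]
    simp only [hG]
    rw [Matrix.mulVec, dotProduct, Finset.sum_div, Finset.mul_sum]
    exact Finset.sum_congr rfl fun b _ => by ring
  · intro H i
    have hG : gammaUp g i x = ((g x)⁻¹ *ᵥ (g x *ᵥ fun b => gammaUp g b x)) i := by
      rw [Matrix.mulVec_mulVec, Matrix.nonsing_inv_mul _ hu, Matrix.one_mulVec]
    have hlow : (g x *ᵥ fun b => gammaUp g b x) = fun a => 2 * (pd a f x / f x) :=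
      funext H
    rw [hG, hlow, Matrix.mulVec, dotProduct, Finset.mul_sum, Finset.mul_sum]
    rw [mul_zero, zero_add, sub_eq_zero]
    exact Finset.sum_congr rfl fun b _ => by field_simp

/-- Proposition 2.5: the identity coordinates are conformal harmonic for `g` iff
the contracted Christoffel symbols satisfy `Γ_a = 2 ∂_a log f` for a positive solution `f` of
`L_g f = 0`. -/
theorem conformal_harmonic_gauge_characterization
    (n k : ℕ) (hn : 3 ≤ n) (hk : 2 ≤ k) (α : ℝ) (hα : α ∈ Set.Ioo (0 : ℝ) 1)
    (U : Set (Pt n)) (hU : IsOpen U)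
    (g : Met n) (hgm : IsMetricOn g U) (hgr : MetCHolderOn k α U g) :
    (∃ (F : Fin n → Pt n → ℝ) (f : Pt n → ℝ),
        (∀ i, ContDiffOn ℝ 2 (F i) U) ∧ ContDiffOn ℝ 2 f U ∧ (∀ x ∈ U, 0 < f x) ∧
        (∀ i, ∀ x ∈ U, confLap g (F i) x = 0) ∧ (∀ x ∈ U, confLap g f x = 0) ∧
        (∀ x ∈ U, ∀ i, x i = F i x / f x))
    ↔
    (∃ f : Pt n → ℝ, ContDiffOn ℝ 2 f U ∧ (∀ x ∈ U, 0 < f x) ∧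
        (∀ x ∈ U, confLap g f x = 0) ∧
        ∀ a : Fin n, ∀ x ∈ U, gammaLow g a x = 2 * pd a (fun y => Real.log (f y)) x) := by
  have hk' : (2 : WithTop ℕ∞) ≤ k := by exact_mod_cast hk
  have hgd : ∀ x ∈ U, ∀ a b, DifferentiableAt ℝ (fun y => g y a b) x := fun x hx a b =>
    (((hgr a b).1.of_le hk').contDiffAt (hU.mem_nhds hx)).differentiableAt (by simp)
  have hdet : ∀ x ∈ U, 0 < (g x).det := fun x hx => (hgm x hx).2.det_pos
  have hs : ∀ x ∈ U, ∀ᶠ y in 𝓝 x, (g y).IsSymm := fun x hx => by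
    filter_upwards [hU.mem_nhds hx] with y hy using (hgm y hy).1
  constructor
  · rintro ⟨F, f, -, hf, hpos, hLF, hLf, hxF⟩
    refine ⟨f, hf, hpos, hLf, fun a x hx => ?_⟩
    refine (confLap_coord_mul_eq_zero_iff (hgd x hx) (hdet x hx) (hs x hx)
      (hf.contDiffAt (hU.mem_nhds hx)) (hpos x hx) (hLf x hx)).1 (fun i => ?_) a
    rw [← hLF i x hx]
    refine confLap_congr ?_
    filter_upwards [hU.mem_nhds hx] with y hy
    rw [hxF y hy i, div_mul_cancel₀ _ (hpos y hy).ne']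
  · rintro ⟨f, hf, hpos, hLf, hG⟩
    refine ⟨fun i y => y i * f y, f, fun i => ?_, hf, hpos, fun i x hx => ?_, hLf,
      fun x hx i => (mul_div_cancel_right₀ _ (hpos x hx).ne').symm⟩
    · exact (contDiff_apply ℝ ℝ i).contDiffOn.mul hf
    · exact (confLap_coord_mul_eq_zero_iff (hgd x hx) (hdet x hx) (hs x hx)
        (hf.contDiffAt (hU.mem_nhds hx)) (hpos x hx) (hLf x hx)).2 (fun a => hG a x hx) i
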